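/- There exists ε₀ > 0 such that for every ε ∈ (0,ε₀) and every C > 0 there exists N with the following property: for all n ≥ N and all integers t with 1 ≤ t ≤ s = ⌈C·log n⌉, |X2(n,t)| < 2^{2H(ε)·n·t}·(3/4)^{0.2·n·t}·4^{n·t}·F(n−2t), where H(ε) = −ε·log ε − (1−ε)·log(1−ε) (log base 2). -/

import Mathlib

open Filter

noncomputable section

/-- A colored graph on `Fin n`: a simple graph whose edges are partitioned
into red and blue edges. -/
structure ColoredGraph (n : ℕ) where
  red : SimpleGraph (Fin n)
  blue : SimpleGraph (Fin n)
  disj : ∀ x y, ¬ (red.Adj x y ∧ blue.Adj x y)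

namespace ColoredGraph

variable {n : ℕ}

/-- The underlying (uncolored) simple graph. -/
def graph (G : ColoredGraph n) : SimpleGraph (Fin n) := G.red ⊔ G.blue

/-- Adjacency in a colored graph. -/
def Adj (G : ColoredGraph n) (x y : Fin n) : Prop := G.graph.Adj x y

/-- The neighborhood of a vertex. -/
def nbhd (G : ColoredGraph n) (x : Fin n) : Set (Fin n) := {y | G.Adj x y}

/-- `Γ(Q)`, the external neighborhood of a set of vertices. -/
def nbhdSet (G : ColoredGraph n) (Q : Set (Fin n)) : Set (Fin n) :=
  (⋃ x ∈ Q, G.nbhd x) \ Q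

/-- The degree of a vertex. -/
def deg (G : ColoredGraph n) (x : Fin n) : ℕ := (G.nbhd x).ncard

open scoped Classical in
/-- Indicator that the edge `xy` is blue. -/
def blueInd (G : ColoredGraph n) (x y : Fin n) : ℕ := if G.blue.Adj x y then 1 else 0

/-- Odd-blue-triangle-free: no triangle with an odd number of blue edges. -/
def OBTF (G : ColoredGraph n) : Prop :=
  ∀ x y z : Fin n, G.Adj x y → G.Adj y z → G.Adj x z →
    ¬ Odd (G.blueInd x y + G.blueInd y z + G.blueInd x z)

/-- The colored graph induced on the vertex set `A` is blue-bipartite: there is a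
partition `U ⊔ (A \ U)` of `A` such that blue edges within `A` cross the partition
and red edges within `A` do not. -/
def BlueBipartiteOn (G : ColoredGraph n) (A : Set (Fin n)) : Prop :=
  ∃ U ⊆ A, ∀ x ∈ A, ∀ y ∈ A,
    (G.blue.Adj x y → (x ∈ U ↔ y ∉ U)) ∧ (G.red.Adj x y → (x ∈ U ↔ y ∈ U))

/-- Blue-bipartite colored graph. -/
def BlueBipartite (G : ColoredGraph n) : Prop := G.BlueBipartiteOn Set.univ

/-- `κ(G)`: the minimum size of a vertex set whose removal leaves a blue-bipartite graph. -/
def kappa (G : ColoredGraph n) : ℕ :=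
  sInf {k | ∃ K : Set (Fin n), K.ncard = k ∧ G.BlueBipartiteOn Kᶜ}

end ColoredGraph

/-- `𝓕(n)`: the set of OBTF colored graphs on `[n]`. -/
def obtfSet (n : ℕ) : Set (ColoredGraph n) := {G | G.OBTF}

/-- `F(n) = |𝓕(n)|`. -/
def Fnum (n : ℕ) : ℕ := (obtfSet n).ncard

/-- `𝓑(n)`: the set of blue-bipartite colored graphs on `[n]`. -/
def bbSet (n : ℕ) : Set (ColoredGraph n) := {G | G.BlueBipartite}

/-- `|𝓑(n)|`. -/
def Bnum (n : ℕ) : ℕ := (bbSet n).ncard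

/-- `b(n) = 2^{n(n+1)/2 - 1}`. -/
def bnum (n : ℕ) : ℕ := 2 ^ (n * (n + 1) / 2 - 1)

/-- The binary entropy function (logarithms base 2). -/
def binH (x : ℝ) : ℝ := -x * Real.logb 2 x - (1 - x) * Real.logb 2 (1 - x)

/-- `K1(G)`: the set of vertices of degree less than `ε n`. -/
def K1 {n : ℕ} (G : ColoredGraph n) (ε : ℝ) : Set (Fin n) :=
  {x | (G.deg x : ℝ) < ε * n}

/-- `κ1(G) = |K1(G)|`. -/
def kappa1 {n : ℕ} (G : ColoredGraph n) (ε : ℝ) : ℕ := (K1 G ε).ncard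

/-- `X1(n,t)`: OBTF graphs with `κ1(G) ≥ t`. -/
def X1set (n t : ℕ) (ε : ℝ) : Set (ColoredGraph n) :=
  {G ∈ obtfSet n | t ≤ kappa1 G ε}

/-- `X0(n,t)`: OBTF graphs on `[n]` having a `t`-set of vertices `Q` with
`|Γ(Q)| < 0.6 n`. -/
def X0set (n t : ℕ) : Set (ColoredGraph n) :=
  {G ∈ obtfSet n | ∃ Q : Set (Fin n), Q.ncard = t ∧ ((G.nbhdSet Q).ncard : ℝ) < 0.6 * n}

/-- A collection witnessing `κ2(G) ≥ l`: `2l` distinct vertices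
`x_1,…,x_l,y_1,…,y_l ∈ [n] ∖ K1(G)` with `|Γ(x_i) ∩ Γ(y_i)| < ε n` for all `i`. -/
def IsK2Coll {n : ℕ} (G : ColoredGraph n) (ε : ℝ) (l : ℕ)
    (f : Fin l ⊕ Fin l → Fin n) : Prop :=
  Function.Injective f ∧ (∀ v, f v ∉ K1 G ε) ∧
    ∀ i : Fin l, ((G.nbhd (f (Sum.inl i)) ∩ G.nbhd (f (Sum.inr i))).ncard : ℝ) < ε * n

/-- `κ2(G)`: the largest `l` admitting a collection as above. -/
def kappa2 {n : ℕ} (G : ColoredGraph n) (ε : ℝ) : ℕ :=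
  sSup {l | ∃ f : Fin l ⊕ Fin l → Fin n, IsK2Coll G ε l f}

/-- `X2(n,t)`: graphs in `𝓕(n) ∖ (X0(n) ∪ X1(n))` with `κ2(G) ≥ t`,
where `X0(n) = X0(n,s)`, `X1(n) = X1(n,s)`, `s = ⌈C log₂ n⌉`. -/
def X2set (n t : ℕ) (ε C : ℝ) : Set (ColoredGraph n) :=
  {G ∈ obtfSet n \ (X0set n ⌈C * Real.logb 2 n⌉₊ ∪ X1set n ⌈C * Real.logb 2 n⌉₊ ε) |
    t ≤ kappa2 G ε}

section aux
open Finset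
open scoped Classical

/-- number of small subsets -/
theorem aux_W (m n : ℕ) (hmn : m ≤ n) (ε : ℝ) (h0 : 0 < ε) (h1 : ε < 1/4) :
    ((univ.filter (fun I : Finset (Fin m) => (I.card : ℝ) < ε * n)).card : ℝ) ≤ (2:ℝ) ^ (binH ε * n) := by
  have hs := Fintype.sum_pow_mul_eq_add_pow (Fin m) ε (1-ε)
  have e1 : ε + (1 - ε) = 1 := by ring
  rw [e1, one_pow] at hs
  have hε1 : 0 < 1 - ε := by linarith
  have h2 : (2:ℝ) ^ (binH ε * n) = (ε ^ (ε * n) * (1-ε) ^ ((1-ε) * n))⁻¹ := by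
    have a1 : ε ^ (ε * n) = (2:ℝ) ^ (Real.logb 2 ε * (ε * n)) := by
      rw [Real.rpow_mul (by norm_num) (Real.logb 2 ε), Real.rpow_logb (by norm_num) (by norm_num) h0]
    have a2 : (1-ε) ^ ((1-ε) * n) = (2:ℝ) ^ (Real.logb 2 (1-ε) * ((1-ε) * n)) := by
      rw [Real.rpow_mul (by norm_num) (Real.logb 2 (1-ε)), Real.rpow_logb (by norm_num) (by norm_num) hε1]
    rw [a1, a2, ← Real.rpow_add (by norm_num), ← Real.rpow_neg (by norm_num)]
    congr 1
    unfold binH; ring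
  have hpos : 0 < ε ^ (ε * n) * (1-ε) ^ ((1-ε) * n) := by positivity
  rw [h2, ← one_div, le_div_iff₀ hpos]
  calc _ = ∑ I ∈ univ.filter (fun I : Finset (Fin m) => (I.card : ℝ) < ε * n), ε ^ (ε * n) * (1-ε) ^ ((1-ε) * n) := by
        rw [sum_const, nsmul_eq_mul]
    _ ≤ ∑ I ∈ univ.filter (fun I : Finset (Fin m) => (I.card : ℝ) < ε * n), ε ^ I.card * (1-ε) ^ (Fintype.card (Fin m) - I.card) := by
        apply sum_le_sum
        intro I hI
        simp only [mem_filter, mem_univ, true_and] at hI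
        have hIm : I.card ≤ m := by simpa using card_le_univ I
        rw [Fintype.card_fin, ← Real.rpow_natCast, ← Real.rpow_natCast, Nat.cast_sub hIm]
        have hmn' : (m:ℝ) ≤ n := by exact_mod_cast hmn
        have b1 : (1-ε) ^ ((n:ℝ) - I.card) ≤ (1-ε) ^ ((m:ℝ) - I.card) :=
          Real.rpow_le_rpow_of_exponent_ge hε1 (by linarith) (by linarith)
        have b2 : ε ^ (ε * n - I.card) ≤ (1-ε) ^ (ε * n - I.card) :=
          Real.rpow_le_rpow h0.le (by linarith) (by linarith)
        calc ε ^ (ε * n) * (1-ε) ^ ((1-ε) * n)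
            = ε ^ (I.card:ℝ) * (ε ^ (ε * n - I.card) * (1-ε) ^ ((1-ε) * n)) := by
              rw [← mul_assoc, ← Real.rpow_add h0]; congr 2; ring
          _ ≤ ε ^ (I.card:ℝ) * ((1-ε) ^ (ε * n - I.card) * (1-ε) ^ ((1-ε) * n)) := by gcongr
          _ = ε ^ (I.card:ℝ) * (1-ε) ^ ((n:ℝ) - I.card) := by
              rw [← Real.rpow_add hε1]; congr 2; ring
          _ ≤ _ := by gcongr
    _ ≤ ∑ I : Finset (Fin m), ε ^ I.card * (1-ε) ^ (Fintype.card (Fin m) - I.card) := by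
        apply sum_le_sum_of_subset_of_nonneg (filter_subset _ _)
        intros; positivity
    _ = 1 := hs

abbrev OB := Option Bool

def cons {m : ℕ} (h : Fin m → Fin m → OB) (p : Fin m → OB) : Prop :=
  ∀ u v a b c, p u = some a → p v = some b → h u v = some c → b = xor a c

def nbA {m s : ℕ} (h : Fin m → Fin m → OB) (Q : Fin s → Fin m) : Finset (Fin m) :=
  univ.filter (fun z => ∃ j, h (Q j) z ≠ none)

def goodQ {m : ℕ} (s : ℕ) (a : ℝ) (h : Fin m → Fin m → OB) (p : Fin m → OB) (Q : Fin s → Fin m)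
    (c : Fin s → Bool) : Prop :=
  (∀ j, p (Q j) = some (c j)) ∧ cons h p ∧ a ≤ ((nbA h Q).card : ℝ)

def inter {m : ℕ} (w : Fin m → OB × OB) : Finset (Fin m) :=
  univ.filter (fun z => (w z).1 ≠ none ∧ (w z).2 ≠ none)

def PS {m : ℕ} (s : ℕ) (a k : ℝ) (h : Fin m → Fin m → OB) : Finset (Fin m → OB × OB) :=
  univ.filter (fun w => (∃ Q c, goodQ s a h (fun z => (w z).1) Q c) ∧
    (∃ Q c, goodQ s a h (fun z => (w z).2) Q c) ∧ ((inter w).card : ℝ) < k)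

def Lset {m s : ℕ} (h : Fin m → Fin m → OB) (Q : Fin s → Fin m) (c : Fin s → Bool) (z : Fin m) :
    Finset Bool :=
  univ.filter (fun b => ∀ j d, h (Q j) z = some d → b = xor (c j) d)

theorem Lset_card2 {m s : ℕ} (h : Fin m → Fin m → OB) (Q : Fin s → Fin m) (c : Fin s → Bool)
    (z : Fin m) : (Lset h Q c z).card ≤ 2 := by
  simpa using card_le_univ (Lset h Q c z)

theorem Lset_card1 {m s : ℕ} (h : Fin m → Fin m → OB) (Q : Fin s → Fin m) (c : Fin s → Bool)
    (z : Fin m) (hz : z ∈ nbA h Q) : (Lset h Q c z).card ≤ 1 := by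
  simp only [nbA, mem_filter, mem_univ, true_and] at hz
  obtain ⟨j, hj⟩ := hz
  obtain ⟨d, hd⟩ := Option.ne_none_iff_exists'.1 hj
  rw [card_le_one]
  intro x hx y hy
  simp only [Lset, mem_filter, mem_univ, true_and] at hx hy
  rw [hx j d hd, hy j d hd]

theorem mem_Lset {m s : ℕ} {a : ℝ} {h : Fin m → Fin m → OB} {p : Fin m → OB} {Q : Fin s → Fin m}
    {c : Fin s → Bool} (hg : goodQ s a h p Q c) {z : Fin m} {b : Bool} (hb : p z = some b) :
    b ∈ Lset h Q c z := by
  simp only [Lset, mem_filter, mem_univ, true_and]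
  intro j d hd
  exact hg.2.1 _ _ _ _ _ (hg.1 j) hb hd

def Dset (I : Prop) (L L' : Finset Bool) : Finset (OB × OB) :=
  if I then L.image some ×ˢ L'.image some else
    {(none, none)} ∪ L.image (fun b => (some b, none)) ∪ L'.image (fun b => (none, some b))

theorem Dset_card (I A B : Prop) (L L' : Finset Bool) (h2 : L.card ≤ 2) (h2' : L'.card ≤ 2)
    (h1 : A → L.card ≤ 1) (h1' : B → L'.card ≤ 1) :
    ((Dset I L L').card : ℝ) ≤ (if I then 4 else 1) *
      (4 * (3/4:ℝ) ^ ((if A then (1:ℝ) else 0) + (if B then (1:ℝ) else 0) - 1)) := by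
  have key : (5:ℝ) - (if A then (1:ℝ) else 0) - (if B then (1:ℝ) else 0) ≤
      (4 * (3/4:ℝ) ^ ((if A then (1:ℝ) else 0) + (if B then (1:ℝ) else 0) - 1)) := by
    by_cases hA : A <;> by_cases hB : B <;> simp [hA, hB] <;> norm_num
  have c1 : (L.card : ℝ) ≤ 2 - (if A then (1:ℝ) else 0) := by
    by_cases hA : A
    · have := h1 hA
      have : (L.card : ℝ) ≤ 1 := by exact_mod_cast this
      simp [hA]; linarith
    · have : (L.card : ℝ) ≤ 2 := by exact_mod_cast h2
      simp [hA]; linarith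
  have c2 : (L'.card : ℝ) ≤ 2 - (if B then (1:ℝ) else 0) := by
    by_cases hA : B
    · have := h1' hA
      have : (L'.card : ℝ) ≤ 1 := by exact_mod_cast this
      simp [hA]; linarith
    · have : (L'.card : ℝ) ≤ 2 := by exact_mod_cast h2'
      simp [hA]; linarith
  by_cases hI : I
  · have : (Dset I L L').card ≤ 2 * 2 := by
      simp only [Dset, hI, if_true, card_product]
      exact Nat.mul_le_mul (card_image_le.trans h2) (card_image_le.trans h2')
    have : ((Dset I L L').card : ℝ) ≤ 4 := by exact_mod_cast this
    have k2 : (if A then (1:ℝ) else 0) ≤ 1 := by split_ifs <;> norm_num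
    have k3 : (if B then (1:ℝ) else 0) ≤ 1 := by split_ifs <;> norm_num
    simp only [hI, if_true] at *
    linarith
  · have : (Dset I L L').card ≤ 1 + L.card + L'.card := by
      simp only [Dset, hI, if_false]
      refine (card_union_le _ _).trans (add_le_add ((card_union_le _ _).trans (add_le_add ?_ card_image_le)) card_image_le)
      simp
    have : ((Dset I L L').card : ℝ) ≤ 1 + L.card + L'.card := by exact_mod_cast this
    simp only [hI, if_false] at *
    linarith

def Tset {m : ℕ} (s : ℕ) (a : ℝ) (h : Fin m → Fin m → OB) (Q Q' : Fin s → Fin m)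
    (c c' : Fin s → Bool) (I : Finset (Fin m)) : Finset (Fin m → OB × OB) :=
  univ.filter (fun w => goodQ s a h (fun z => (w z).1) Q c ∧ goodQ s a h (fun z => (w z).2) Q' c' ∧
    inter w = I)

theorem Tset_card {m : ℕ} (s : ℕ) (a k : ℝ) (h : Fin m → Fin m → OB) (Q Q' : Fin s → Fin m)
    (c c' : Fin s → Bool) (I : Finset (Fin m)) (hI : (I.card : ℝ) < k) :
    ((Tset s a h Q Q' c c' I).card : ℝ) ≤ 4 ^ k * (4 ^ m * (3/4:ℝ) ^ (2 * a - m)) := by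
  by_cases hne : (Tset s a h Q Q' c c' I).Nonempty
  swap
  · rw [not_nonempty_iff_eq_empty.1 hne]
    simp only [card_empty, Nat.cast_zero]; positivity
  obtain ⟨w0, hw0⟩ := hne
  simp only [Tset, mem_filter, mem_univ, true_and] at hw0
  have ha := hw0.1.2.2
  have ha' := hw0.2.1.2.2
  have hsub : Tset s a h Q Q' c c' I ⊆
      Fintype.piFinset (fun z => Dset (z ∈ I) (Lset h Q c z) (Lset h Q' c' z)) := by
    intro w hw
    simp only [Tset, mem_filter, mem_univ, true_and] at hw
    obtain ⟨g1, g2, rfl⟩ := hw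
    rw [Fintype.mem_piFinset]
    intro z
    have m1 := fun b => @mem_Lset m s a h _ Q c g1 z b
    have m2 := fun b => @mem_Lset m s a h _ Q' c' g2 z b
    simp only [Dset, inter, mem_filter, mem_univ, true_and]
    rcases hwz : w z with ⟨_ | b, _ | b'⟩ <;> simp [hwz] at m1 m2 ⊢
    · exact m2
    · exact m1
    · exact ⟨m1, m2⟩
  calc ((Tset s a h Q Q' c c' I).card : ℝ)
      ≤ ∏ z, ((Dset (z ∈ I) (Lset h Q c z) (Lset h Q' c' z)).card : ℝ) := by
        have := card_le_card hsub
        rw [Fintype.card_piFinset] at this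
        exact_mod_cast this
    _ ≤ ∏ z, ((if z ∈ I then (4:ℝ) else 1) * (4 * (3/4:ℝ) ^ ((if z ∈ nbA h Q then (1:ℝ) else 0) + (if z ∈ nbA h Q' then (1:ℝ) else 0) - 1))) := by
        apply Finset.prod_le_prod
        · intros; positivity
        · intro z _
          refine (Dset_card (z ∈ I) _ _ _ _ (Lset_card2 ..) (Lset_card2 ..) (Lset_card1 h Q c z) (Lset_card1 h Q' c' z)).trans (le_of_eq ?_)
          by_cases hz : z ∈ I <;> by_cases hz1 : z ∈ nbA h Q <;> by_cases hz2 : z ∈ nbA h Q' <;> simp [hz, hz1, hz2]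
    _ = 4 ^ I.card * (4 ^ m * (3/4:ℝ) ^ (((nbA h Q).card : ℝ) + ((nbA h Q').card : ℝ) - m)) := by
        rw [prod_mul_distrib, prod_mul_distrib, ← Real.rpow_sum_of_pos (by norm_num)]
        simp [sum_add_distrib, sum_sub_distrib]
    _ ≤ _ := by
        rw [← Real.rpow_natCast 4 I.card]
        gcongr ?_ * (_ * ?_)
        · exact Real.rpow_le_rpow_of_exponent_le (by norm_num) hI.le
        · exact Real.rpow_le_rpow_of_exponent_ge (by norm_num) (by norm_num) (by linarith)

theorem PS_card {m n : ℕ} (hmn : m ≤ n) (s : ℕ) (a ε : ℝ) (h0 : 0 < ε) (h1 : ε < 1/4)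
    (h : Fin m → Fin m → OB) :
    ((PS s a (ε * n) h).card : ℝ) ≤ ((m:ℝ) ^ s * m ^ s * (2 ^ s * 2 ^ s)) * 2 ^ (binH ε * n) *
      (4 ^ (ε * n) * (4 ^ m * (3/4:ℝ) ^ (2 * a - m))) := by
  set J : Finset (Finset (Fin m)) := univ.filter (fun I : Finset (Fin m) => (I.card : ℝ) < ε * n)
  set K : Finset (((Fin s → Fin m) × (Fin s → Fin m)) × ((Fin s → Bool) × (Fin s → Bool)) × Finset (Fin m)) :=
    univ ×ˢ univ ×ˢ J with hK
  have hsub : PS s a (ε * n) h ⊆ K.biUnion (fun x => Tset s a h x.1.1 x.1.2 x.2.1.1 x.2.1.2 x.2.2) := by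
    intro w hw
    simp only [PS, mem_filter, mem_univ, true_and] at hw
    obtain ⟨⟨Q, c, hg⟩, ⟨Q', c', hg'⟩, hi⟩ := hw
    rw [mem_biUnion]
    refine ⟨((Q, Q'), (c, c'), inter w), ?_, ?_⟩
    · simp [hK, J, hi]
    · simp [Tset, hg, hg']
  have hKc : (K.card : ℝ) = ((m:ℝ) ^ s * m ^ s * (2 ^ s * 2 ^ s)) * J.card := by
    simp [hK, card_product]; ring
  calc ((PS s a (ε * n) h).card : ℝ)
      ≤ ((K.biUnion (fun x => Tset s a h x.1.1 x.1.2 x.2.1.1 x.2.1.2 x.2.2)).card : ℝ) := by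
        exact_mod_cast card_le_card hsub
    _ ≤ ∑ x ∈ K, ((Tset s a h x.1.1 x.1.2 x.2.1.1 x.2.1.2 x.2.2).card : ℝ) := by
        exact_mod_cast card_biUnion_le
    _ ≤ ∑ x ∈ K, (4 ^ (ε * n) * (4 ^ m * (3/4:ℝ) ^ (2 * a - m))) := by
        apply sum_le_sum
        intro x hx
        apply Tset_card
        simpa [hK, J] using hx
    _ = K.card * (4 ^ (ε * n) * (4 ^ m * (3/4:ℝ) ^ (2 * a - m))) := by
        rw [sum_const, nsmul_eq_mul]
    _ ≤ _ := by
        rw [hKc]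
        have := aux_W m n hmn ε h0 h1
        gcongr

def col {n : ℕ} (G : ColoredGraph n) (x y : Fin n) : OB :=
  if G.blue.Adj x y then some true else if G.red.Adj x y then some false else none

theorem col_blue {n : ℕ} (G : ColoredGraph n) (x y : Fin n) :
    col G x y = some true ↔ G.blue.Adj x y := by
  unfold col; split_ifs <;> simp_all

theorem col_red {n : ℕ} (G : ColoredGraph n) (x y : Fin n) :
    col G x y = some false ↔ G.red.Adj x y := by
  have := G.disj x y
  unfold col; split_ifs <;> simp_all

theorem col_none {n : ℕ} (G : ColoredGraph n) (x y : Fin n) :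
    col G x y ≠ none ↔ G.Adj x y := by
  unfold col ColoredGraph.Adj ColoredGraph.graph
  rw [SimpleGraph.sup_adj]
  split_ifs <;> simp_all

theorem col_symm {n : ℕ} (G : ColoredGraph n) (x y : Fin n) : col G x y = col G y x := by
  unfold col; rw [G.blue.adj_comm, G.red.adj_comm]

theorem col_inj {n : ℕ} : Function.Injective (@col n) := by
  intro G H h
  have hb : G.blue = H.blue := by
    ext x y; rw [← col_blue, ← col_blue, h]
  have hr : G.red = H.red := by
    ext x y; rw [← col_red, ← col_red, h]
  cases G; cases H; simp_all

instance {n : ℕ} : Finite (ColoredGraph n) := Finite.of_injective _ (@col_inj n)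

theorem obtf_col {n : ℕ} (G : ColoredGraph n) (hG : G.OBTF) (x y z : Fin n) (a b c : Bool)
    (h1 : col G x y = some a) (h2 : col G x z = some b) (h3 : col G y z = some c) :
    b = xor a c := by
  have := hG x y z ((col_none G x y).1 (by simp [h1])) ((col_none G y z).1 (by simp [h3]))
    ((col_none G x z).1 (by simp [h2]))
  unfold ColoredGraph.blueInd at this
  simp only [← col_blue, h1, h2, h3] at this
  revert this
  cases a <;> cases b <;> cases c <;> simp <;> decide

def pull {m n : ℕ} (e : Fin m ↪ Fin n) (G : ColoredGraph n) : ColoredGraph m where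
  red := G.red.comap e
  blue := G.blue.comap e
  disj := fun x y => G.disj (e x) (e y)

theorem col_pull {m n : ℕ} (e : Fin m ↪ Fin n) (G : ColoredGraph n) (x y : Fin m) :
    col (pull e G) x y = col G (e x) (e y) := by
  simp [col, pull]

theorem pull_obtf {m n : ℕ} (e : Fin m ↪ Fin n) (G : ColoredGraph n) (hG : G.OBTF) :
    (pull e G).OBTF := by
  intro x y z h1 h2 h3
  have := hG (e x) (e y) (e z) ?_ ?_ ?_
  · simpa [ColoredGraph.blueInd, ← col_blue, col_pull] using this
  all_goals rw [← col_none] at *; simpa [col_pull] using ‹_›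

theorem exists_good {m n s t : ℕ} (ε : ℝ) (G : ColoredGraph n) (hG : G.OBTF)
    (h0 : G ∉ X0set n s) (f : Fin t ⊕ Fin t → Fin n) (hst : (s:ℝ) + 2 * t ≤ ε * n)
    (e : Fin m ↪ Fin n) (he : ∀ z, z ∈ Set.range e ∨ z ∈ Set.range f)
    (x : Fin n) (hx : x ∉ K1 G ε) :
    ∃ Q c, goodQ s (0.6 * n - 2 * t) (col (pull e G)) (fun z => col G x (e z)) Q c := by
  have hrf : (Set.range f).ncard ≤ 2 * t := by
    rw [← Set.image_univ]
    refine (Set.ncard_image_le Set.finite_univ).trans ?_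
    rw [Set.ncard_univ]; simp; omega
  set S : Finset (Fin m) := univ.filter (fun z => col G x (e z) ≠ none) with hS
  have hsub : G.nbhd x ⊆ (e '' (S : Set (Fin m))) ∪ Set.range f := by
    intro y hy
    rcases he y with ⟨z, rfl⟩ | h
    · left
      refine ⟨z, ?_, rfl⟩
      simp only [hS, coe_filter, mem_univ, true_and, Set.mem_ofPred_eq]
      rw [col_none]; exact hy
    · right; exact h
  have hdeg : G.deg x ≤ S.card + 2 * t := by
    refine (Set.ncard_le_ncard hsub).trans ((Set.ncard_union_le _ _).trans (add_le_add ?_ hrf))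
    refine (Set.ncard_image_le (Set.toFinite _)).trans ?_
    rw [Set.ncard_coe_finset]
  have hSs : s ≤ S.card := by
    have h1 : ε * n ≤ G.deg x := by
      simpa [K1] using hx
    have h2 : (G.deg x : ℝ) ≤ S.card + 2 * t := by exact_mod_cast hdeg
    have : (s:ℝ) ≤ S.card := by linarith
    exact_mod_cast this
  obtain ⟨S', hS', hc⟩ := exists_subset_card_eq hSs
  set Q : Fin s → Fin m := fun j => S'.orderEmbOfFin hc j with hQ
  have hQi : Function.Injective Q := (S'.orderEmbOfFin hc).injective
  have hQm : ∀ j, col G x (e (Q j)) ≠ none := by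
    intro j
    have := hS' (S'.orderEmbOfFin_mem hc j)
    simpa [hS] using this
  choose c hcc using fun j => Option.ne_none_iff_exists'.1 (hQm j)
  refine ⟨Q, c, hcc, ?_, ?_⟩
  · intro u v a b d h1 h2 h3
    rw [col_pull] at h3
    exact obtf_col G hG _ _ _ _ _ _ h1 h2 h3
  · have hq : (Set.range (fun j => e (Q j))).ncard = s := by
      rw [← Set.image_univ, Set.ncard_image_of_injective _ (show Function.Injective (fun j => e (Q j)) from e.injective.comp hQi), Set.ncard_univ]
      simp
    have hbig : 0.6 * (n:ℝ) ≤ ((G.nbhdSet (Set.range (fun j => e (Q j)))).ncard : ℝ) := by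
      by_contra hlt
      exact h0 ⟨hG, _, hq, not_le.1 hlt⟩
    have hsub2 : G.nbhdSet (Set.range (fun j => e (Q j))) ⊆
        (e '' (nbA (col (pull e G)) Q : Set (Fin m))) ∪ Set.range f := by
      intro y hy
      rcases he y with ⟨z, rfl⟩ | h
      · left
        refine ⟨z, ?_, rfl⟩
        have hy1 := hy.1
        simp only [Set.mem_iUnion] at hy1
        obtain ⟨_, ⟨j, rfl⟩, hj⟩ := hy1
        simp only [nbA, coe_filter, mem_univ, true_and, Set.mem_ofPred_eq]
        refine ⟨j, ?_⟩
        rw [col_pull, col_none]; exact hj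
      · right; exact h
    have hle : (G.nbhdSet (Set.range (fun j => e (Q j)))).ncard ≤ (nbA (col (pull e G)) Q).card + 2 * t := by
      refine (Set.ncard_le_ncard hsub2).trans ((Set.ncard_union_le _ _).trans (add_le_add ?_ hrf))
      refine (Set.ncard_image_le (Set.toFinite _)).trans ?_
      rw [Set.ncard_coe_finset]
    have hle' : ((G.nbhdSet (Set.range (fun j => e (Q j)))).ncard : ℝ) ≤ (nbA (col (pull e G)) Q).card + 2 * t := by
      exact_mod_cast hle
    linarith

theorem fix_count {n t s : ℕ} (ε : ℝ) (f : Fin t ⊕ Fin t → Fin n) (hf : Function.Injective f)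
    (hst : (s:ℝ) + 2 * t ≤ ε * n) (M : ℝ)
    (hM : ∀ h : Fin (n - 2 * t) → Fin (n - 2 * t) → OB,
      ((PS s (0.6 * n - 2 * t) (ε * n) h).card : ℝ) ≤ M) :
    (({G : ColoredGraph n | G.OBTF ∧ G ∉ X0set n s ∧ IsK2Coll G ε t f}).ncard : ℝ) ≤
      Fnum (n - 2 * t) * 3 ^ (4 * t * t) * M ^ t := by
  set m := n - 2 * t with hm
  have hcard : Fintype.card ((Set.range f)ᶜ : Set (Fin n)) = Fintype.card (Fin m) := by
    rw [Fintype.card_compl_set, Set.card_range_of_injective hf]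
    simp [hm]; omega
  let e0 : Fin m ≃ ((Set.range f)ᶜ : Set (Fin n)) := (Fintype.equivOfCardEq hcard).symm
  let e : Fin m ↪ Fin n := e0.toEmbedding.trans (Function.Embedding.subtype _)
  have he : ∀ z, z ∈ Set.range e ∨ z ∈ Set.range f := by
    intro z
    by_cases hz : z ∈ Set.range f
    · exact Or.inr hz
    · left
      exact ⟨e0.symm ⟨z, hz⟩, by simp [e]⟩
  set P := fun h : Fin m → Fin m → OB => PS s (0.6 * n - 2 * t) (ε * n) h with hP
  have hfin : (obtfSet m).Finite := Set.toFinite _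
  set Himg : Finset (Fin m → Fin m → OB) := hfin.toFinset.image col with hH
  set K : Finset ((Fin m → Fin m → OB) × ((Fin t ⊕ Fin t) → (Fin t ⊕ Fin t) → OB)) :=
    Himg ×ˢ univ with hK
  set B : Finset (((Fin m → Fin m → OB) × ((Fin t ⊕ Fin t) → (Fin t ⊕ Fin t) → OB)) ×
      (Fin t → Fin m → OB × OB)) :=
    K.biUnion (fun x => (Fintype.piFinset (fun _ : Fin t => P x.1)).image (fun w => (x, w))) with hB
  set Φ : ColoredGraph n → ((Fin m → Fin m → OB) × ((Fin t ⊕ Fin t) → (Fin t ⊕ Fin t) → OB)) ×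
      (Fin t → Fin m → OB × OB) := fun G =>
    ((col (pull e G), fun u v => col G (f u) (f v)),
      fun i z => (col G (f (Sum.inl i)) (e z), col G (f (Sum.inr i)) (e z))) with hΦ
  have hΦi : Function.Injective Φ := by
    intro G H h
    apply col_inj
    simp only [hΦ, Prod.mk.injEq] at h
    obtain ⟨⟨h1, h2⟩, h3⟩ := h
    have k1 : ∀ u v, col G (e u) (e v) = col H (e u) (e v) := by
      intro u v
      rw [← col_pull, ← col_pull, h1]
    have k2 : ∀ u v, col G (f u) (f v) = col H (f u) (f v) := fun u v => congrFun (congrFun h2 u) v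
    have k3 : ∀ u z, col G (f u) (e z) = col H (f u) (e z) := by
      intro u z
      rcases u with i | i
      · exact congrArg Prod.fst (congrFun (congrFun h3 i) z)
      · exact congrArg Prod.snd (congrFun (congrFun h3 i) z)
    funext x y
    rcases he x with ⟨x, rfl⟩ | ⟨x, rfl⟩ <;> rcases he y with ⟨y, rfl⟩ | ⟨y, rfl⟩
    · exact k1 _ _
    · rw [col_symm G, col_symm H]; exact k3 _ _
    · exact k3 _ _
    · exact k2 _ _
  have hmaps : ∀ G ∈ {G : ColoredGraph n | G.OBTF ∧ G ∉ X0set n s ∧ IsK2Coll G ε t f},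
      Φ G ∈ (B : Set _) := by
    rintro G ⟨g1, g2, g3⟩
    rw [mem_coe, hB, mem_biUnion]
    refine ⟨(Φ G).1, ?_, ?_⟩
    · simp only [hK, mem_product, mem_univ, and_true, hH, mem_image, Set.Finite.mem_toFinset]
      exact ⟨pull e G, pull_obtf e G g1, rfl⟩
    · rw [mem_image]
      refine ⟨(Φ G).2, ?_, rfl⟩
      rw [Fintype.mem_piFinset]
      intro i
      simp only [hP, PS, mem_filter, mem_univ, true_and]
      refine ⟨exists_good ε G g1 g2 f hst e he _ (g3.2.1 _),
        exists_good ε G g1 g2 f hst e he _ (g3.2.1 _), ?_⟩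
      refine lt_of_le_of_lt ?_ (g3.2.2 i)
      have : (inter ((Φ G).2 i)).card ≤
          (G.nbhd (f (Sum.inl i)) ∩ G.nbhd (f (Sum.inr i))).ncard := by
        rw [← Set.ncard_coe_finset, ← Set.ncard_image_of_injective _ e.injective]
        apply Set.ncard_le_ncard _ (Set.toFinite _)
        rintro _ ⟨z, hz, rfl⟩
        simp only [inter, coe_filter, mem_univ, true_and, Set.mem_ofPred_eq, hΦ, col_none] at hz
        exact hz
      exact_mod_cast this
  have hle : ({G : ColoredGraph n | G.OBTF ∧ G ∉ X0set n s ∧ IsK2Coll G ε t f}).ncard ≤ B.card := by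
    rw [← Set.ncard_coe_finset]
    exact Set.ncard_le_ncard_of_injOn Φ hmaps hΦi.injOn (Set.toFinite _)
  have hHc : (Himg.card : ℝ) ≤ Fnum m := by
    have : Himg.card ≤ Fnum m := by
      refine card_image_le.trans ?_
      rw [Fnum, Set.ncard_eq_toFinset_card _ hfin]
    exact_mod_cast this
  have hM0 : 0 ≤ M := le_trans (Nat.cast_nonneg _) (hM (fun _ _ => none))
  calc _ ≤ (B.card : ℝ) := by exact_mod_cast hle
    _ ≤ ∑ x ∈ K, (((Fintype.piFinset (fun _ : Fin t => P x.1)).image (fun w => (x, w))).card : ℝ) := by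
        exact_mod_cast card_biUnion_le
    _ ≤ ∑ x ∈ K, M ^ t := by
        apply sum_le_sum
        intro x _
        have h1 : ((Fintype.piFinset (fun _ : Fin t => P x.1)).image (fun w => (x, w))).card ≤ (P x.1).card ^ t := by
          refine card_image_le.trans ?_
          simp [Fintype.card_piFinset]
        calc _ ≤ ((P x.1).card : ℝ) ^ t := by exact_mod_cast h1
          _ ≤ M ^ t := by
            have := hM x.1
            gcongr
    _ = Himg.card * 3 ^ (4 * t * t) * M ^ t := by
        rw [sum_const, nsmul_eq_mul]
        congr 1
        rw [hK, card_product]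
        push_cast
        rw [show 4 * t * t = (t + t) * (t + t) by ring]
        simp [pow_mul]
    _ ≤ _ := by gcongr

theorem coll_of_kappa2 {n t : ℕ} (G : ColoredGraph n) (ε : ℝ) (ht : t ≤ kappa2 G ε) :
    ∃ f : Fin t ⊕ Fin t → Fin n, IsK2Coll G ε t f := by
  have hne : {l | ∃ f : Fin l ⊕ Fin l → Fin n, IsK2Coll G ε l f}.Nonempty := by
    refine ⟨0, Sum.elim Fin.elim0 Fin.elim0, ?_, ?_, ?_⟩
    · rintro (x | x) <;> exact x.elim0
    · rintro (x | x) <;> exact x.elim0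
    · intro x; exact x.elim0
  have hbd : BddAbove {l | ∃ f : Fin l ⊕ Fin l → Fin n, IsK2Coll G ε l f} := by
    refine ⟨n, ?_⟩
    rintro l ⟨f, hf, -⟩
    have := Fintype.card_le_of_injective f hf
    simp at this
    omega
  obtain ⟨f, h1, h2, h3⟩ := Nat.sSup_mem hne hbd
  refine ⟨fun v => f (Sum.map (Fin.castLE ht) (Fin.castLE ht) v), ?_, ?_, ?_⟩
  · exact h1.comp (Sum.map_injective.2 ⟨Fin.castLE_injective ht, Fin.castLE_injective ht⟩)
  · intro v; exact h2 _
  · intro i; exact h3 _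

theorem X2_le {n t s : ℕ} (ε C : ℝ) (hs : s = ⌈C * Real.logb 2 n⌉₊)
    (hst : (s:ℝ) + 2 * t ≤ ε * n) (M : ℝ)
    (hM : ∀ h : Fin (n - 2 * t) → Fin (n - 2 * t) → OB,
      ((PS s (0.6 * n - 2 * t) (ε * n) h).card : ℝ) ≤ M) :
    ((X2set n t ε C).ncard : ℝ) ≤
      n ^ (2 * t) * (Fnum (n - 2 * t) * 3 ^ (4 * t * t) * M ^ t) := by
  have hM0 : 0 ≤ M := le_trans (Nat.cast_nonneg _) (hM (fun _ _ => none))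
  have hsub : X2set n t ε C ⊆ ⋃ f ∈ (univ : Finset (Fin t ⊕ Fin t → Fin n)),
      {G : ColoredGraph n | G.OBTF ∧ G ∉ X0set n s ∧ IsK2Coll G ε t f} := by
    rintro G ⟨⟨h1, h2⟩, h3⟩
    obtain ⟨f, hf⟩ := coll_of_kappa2 G ε h3
    simp only [mem_univ, Set.iUnion_true, Set.mem_iUnion]
    refine ⟨f, h1, ?_, hf⟩
    rw [hs]
    exact fun h => h2 (Or.inl h)
  calc ((X2set n t ε C).ncard : ℝ) ≤ ∑ f : (Fin t ⊕ Fin t → Fin n),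
      (({G : ColoredGraph n | G.OBTF ∧ G ∉ X0set n s ∧ IsK2Coll G ε t f}).ncard : ℝ) := by
        have := (Set.ncard_le_ncard hsub (Set.toFinite _)).trans (Finset.set_ncard_biUnion_le _ _)
        exact_mod_cast this
    _ ≤ ∑ f : (Fin t ⊕ Fin t → Fin n), (Fnum (n - 2 * t) * 3 ^ (4 * t * t) * M ^ t : ℝ) := by
        apply sum_le_sum
        intro f _
        by_cases hf : Function.Injective f
        · exact fix_count ε f hf hst M hM
        · have : {G : ColoredGraph n | G.OBTF ∧ G ∉ X0set n s ∧ IsK2Coll G ε t f} = ∅ := by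
            ext G
            simp only [Set.mem_ofPred_eq, Set.mem_empty_iff_false, iff_false]
            exact fun h => hf h.2.2.1
          rw [this]
          simp only [Set.ncard_empty, Nat.cast_zero]
          positivity
    _ = _ := by
        rw [sum_const, nsmul_eq_mul]
        congr 1
        simp [two_mul]

theorem Fnum_pos (m : ℕ) : 0 < Fnum m := by
  rw [Fnum, Set.ncard_pos (Set.toFinite _)]
  refine ⟨⟨⊥, ⊥, by simp⟩, ?_⟩
  intro x y z h
  simp [ColoredGraph.Adj, ColoredGraph.graph] at h

theorem binH_gt (ε : ℝ) (h0 : 0 < ε) (h1 : ε < 1/4) : 2 * ε < binH ε := by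
  have a1 : Real.logb 2 ε < -2 := by
    rw [Real.logb_lt_iff_lt_rpow (by norm_num) h0]
    rw [show (-2:ℝ) = ((-2:ℤ):ℝ) by norm_num, Real.rpow_intCast]
    norm_num; linarith
  have a2 : Real.logb 2 (1-ε) ≤ 0 := Real.logb_nonpos (by norm_num) (by linarith) (by linarith)
  unfold binH
  nlinarith

theorem asym (ε C δ : ℝ) (hε : 0 < ε) (hC : 0 < C) (hδ : 0 < δ) :
    ∃ N : ℕ, ∀ n : ℕ, N ≤ n → 1 ≤ n ∧ (3:ℝ) * ⌈C * Real.logb 2 n⌉₊ ≤ ε * n ∧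
      (n:ℝ)^2 * 81 ^ ⌈C * Real.logb 2 n⌉₊ * (n ^ ⌈C * Real.logb 2 n⌉₊ * n ^ ⌈C * Real.logb 2 n⌉₊ *
        (2 ^ ⌈C * Real.logb 2 n⌉₊ * 2 ^ ⌈C * Real.logb 2 n⌉₊)) < 2 ^ (δ * n) := by
  have key : ∀ k : ℕ, ∀ η : ℝ, 0 < η → ∀ᶠ n : ℕ in atTop, (Real.logb 2 n) ^ k ≤ η * n := by
    intro k η hη
    have h2 : 0 < Real.log 2 := Real.log_pos (by norm_num)
    have h := (@Real.isLittleO_pow_log_id_atTop k).bound (c := η * Real.log 2 ^ k) (by positivity)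
    have h' := tendsto_natCast_atTop_atTop (R := ℝ) |>.eventually h
    filter_upwards [h'] with n hn
    have := (le_abs_self _).trans hn
    simp only [id, Real.norm_eq_abs, Nat.abs_cast] at this
    rw [Real.logb, div_pow, div_le_iff₀ (by positivity)]
    linarith
  set A := 2 * C with hA
  set D := 4 + 9 * C with hD
  have hApos : 0 < A := by positivity
  have hDpos : 0 < D := by positivity
  have e1 := key 2 (δ / (4 * A)) (by positivity)
  have e2 := key 1 (δ / (4 * D)) (by positivity)
  have e3 := key 0 (δ / (4 * 9)) (by positivity)
  have e4 := key 1 (ε / (6 * C)) (by positivity)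
  have e5 := key 0 (ε / 6) (by positivity)
  obtain ⟨N, hN⟩ := eventually_atTop.1 ((((e1.and e2).and e3).and (e4.and e5)).and (eventually_ge_atTop 1))
  refine ⟨N, fun n hn => ?_⟩
  obtain ⟨⟨⟨⟨e1, e2⟩, e3⟩, e4, e5⟩, e6⟩ := hN n hn
  set L := Real.logb 2 n with hL
  have hn1 : (1:ℝ) ≤ n := by exact_mod_cast e6
  have hL0 : 0 ≤ L := Real.logb_nonneg (by norm_num) hn1
  have hs : (⌈C * L⌉₊ : ℝ) ≤ C * L + 1 := (Nat.ceil_lt_add_one (by positivity)).le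
  set s := ⌈C * L⌉₊
  rw [pow_one] at e2 e4
  rw [pow_zero] at e3 e5
  have f1 : A * L ^ 2 ≤ δ * n / 4 := by
    have := mul_le_mul_of_nonneg_left e1 hApos.le
    have k : A * (δ / (4 * A) * n) = δ * n / 4 := by field_simp
    linarith
  have f2 : D * L ≤ δ * n / 4 := by
    have := mul_le_mul_of_nonneg_left e2 hDpos.le
    have k : D * (δ / (4 * D) * n) = δ * n / 4 := by field_simp
    linarith
  have f4 : C * L ≤ ε * n / 6 := by
    have := mul_le_mul_of_nonneg_left e4 hC.le
    have k : C * (ε / (6 * C) * n) = ε * n / 6 := by field_simp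
    linarith
  refine ⟨e6, by linarith, ?_⟩
  have hnL : (n:ℝ) = 2 ^ L := by
    rw [hL, Real.rpow_logb (by norm_num) (by norm_num) (by linarith)]
  have h81 : (81:ℝ) ^ s ≤ 2 ^ ((7:ℝ) * s) := by
    rw [Real.rpow_mul (by norm_num), Real.rpow_natCast]
    gcongr
    rw [show (7:ℝ) = ((7:ℕ):ℝ) by norm_num, Real.rpow_natCast]; norm_num
  have hp : ∀ k : ℕ, (n:ℝ) ^ k = 2 ^ (L * k) := by
    intro k
    rw [Real.rpow_mul (by norm_num), ← hnL, Real.rpow_natCast]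
  calc _ ≤ (2:ℝ) ^ (L * (2:ℕ)) * 2 ^ ((7:ℝ) * s) * (2 ^ (L * s) * 2 ^ (L * s) * (2 ^ (s:ℝ) * 2 ^ (s:ℝ))) := by
        rw [← hp, ← hp, Real.rpow_natCast]
        gcongr
    _ = 2 ^ (2 * L + 7 * s + (2 * L * s + 2 * s)) := by
        simp only [← Real.rpow_add (show (0:ℝ) < 2 by norm_num)]
        congr 1; push_cast; ring
    _ < 2 ^ (δ * n) := by
        apply Real.rpow_lt_rpow_of_exponent_lt (by norm_num)
        have hLs : L * s ≤ L * (C * L + 1) := mul_le_mul_of_nonneg_left hs hL0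
        have : 0 < δ * n := by positivity
        have e7 : 9 ≤ δ * n / 4 := by linarith
        nlinarith

end aux

/-- Lemma 3.4: there is an `ε₀ > 0` such that for all `ε ∈ (0,ε₀)` and `C > 0`, for
large `n` and `1 ≤ t ≤ s = ⌈C log₂ n⌉`,
`|X2(n,t)| < 2^{2H(ε)nt} (3/4)^{0.2nt} 4^{nt} F(n-2t)`. -/
theorem X2_count :
    ∃ ε₀ : ℝ, 0 < ε₀ ∧ ∀ ε : ℝ, 0 < ε → ε < ε₀ → ∀ C : ℝ, 0 < C →
      ∃ N : ℕ, ∀ n : ℕ, N ≤ n → ∀ t : ℕ, 1 ≤ t → t ≤ ⌈C * Real.logb 2 n⌉₊ →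
        ((X2set n t ε C).ncard : ℝ) <
          (2 : ℝ) ^ (2 * binH ε * n * t) * ((3 : ℝ) / 4) ^ ((0.2 : ℝ) * n * t) *
            (4 : ℝ) ^ (n * t) * Fnum (n - 2 * t) := by
  refine ⟨1/4, by norm_num, fun ε h0 h1 C hC => ?_⟩
  have hH := binH_gt ε h0 h1
  obtain ⟨N, hN⟩ := asym ε C (binH ε - 2 * ε) h0 hC (by linarith)
  refine ⟨N, fun n hn t ht1 hts => ?_⟩
  obtain ⟨hn1, hs3, hbig⟩ := hN n hn
  set s := ⌈C * Real.logb 2 n⌉₊ with hs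
  have hts' : (t:ℝ) ≤ s := by exact_mod_cast hts
  have hn0 : (0:ℝ) < n := by exact_mod_cast hn1
  have h2t : 2 * t ≤ n := by
    have : (2:ℝ) * t ≤ n := by nlinarith
    exact_mod_cast this
  have hX := X2_le (n := n) (t := t) (s := s) ε C hs (by linarith) _
    (fun h => PS_card (Nat.sub_le n (2 * t)) s (0.6 * n - 2 * t) ε h0 h1 h)
  refine lt_of_le_of_lt hX ?_
  set m := n - 2 * t with hm
  have hmn : (m:ℝ) = n - 2 * t := by rw [hm, Nat.cast_sub h2t]; push_cast; ring
  have hmn' : (m:ℝ) ≤ n := by rw [hmn]; have : (0:ℝ) ≤ t := Nat.cast_nonneg _; linarith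
  have hFpos : (0:ℝ) < Fnum m := by exact_mod_cast Fnum_pos m
  -- the tail factor
  have htail : (4:ℝ) ^ m * (3/4:ℝ) ^ (2 * (0.6 * (n:ℝ) - 2 * t) - m) ≤ 4 ^ n * (3/4:ℝ) ^ (0.2 * (n:ℝ)) := by
    have q1 : (3/4:ℝ) ^ (2 * (0.6 * (n:ℝ) - 2 * t) - m) = (3/4:ℝ) ^ (0.2 * (n:ℝ)) * ((3/4:ℝ) ^ (2 * t))⁻¹ := by
      rw [← Real.rpow_natCast, ← Real.rpow_neg (by norm_num), ← Real.rpow_add (by norm_num)]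
      congr 1; rw [hmn]; push_cast; ring
    have q2 : (4:ℝ) ^ n = 4 ^ m * 4 ^ (2 * t) := by
      rw [← pow_add]; congr 1; omega
    have q3 : ((3/4:ℝ) ^ (2 * t))⁻¹ ≤ 4 ^ (2 * t) := by
      rw [← inv_pow]
      gcongr; norm_num
    rw [q1, q2]
    calc _ = 4 ^ m * (3/4:ℝ) ^ (0.2 * (n:ℝ)) * ((3/4:ℝ) ^ (2 * t))⁻¹ := by ring
      _ ≤ 4 ^ m * (3/4:ℝ) ^ (0.2 * (n:ℝ)) * 4 ^ (2 * t) := by gcongr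
      _ = _ := by ring
  set T := (4:ℝ) ^ m * (3/4:ℝ) ^ (2 * (0.6 * (n:ℝ) - 2 * t) - m) with hT
  have hT0 : 0 ≤ T := by positivity
  have h4 : (4:ℝ) ^ (ε * n) = 2 ^ (2 * ε * n) := by
    rw [show (4:ℝ) = 2 ^ (2:ℝ) by norm_num, ← Real.rpow_mul (by norm_num)]
    congr 1; ring
  have hper : (n:ℝ) ^ 2 * 81 ^ t * (((m:ℝ) ^ s * m ^ s * (2 ^ s * 2 ^ s)) * 2 ^ (binH ε * n) *
      (4 ^ (ε * n) * T)) < 2 ^ (2 * binH ε * n) * (3/4:ℝ) ^ (0.2 * (n:ℝ)) * 4 ^ n := by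
    calc _ ≤ (n:ℝ) ^ 2 * 81 ^ s * (((n:ℝ) ^ s * n ^ s * (2 ^ s * 2 ^ s)) * 2 ^ (binH ε * n) *
      (4 ^ (ε * n) * (4 ^ n * (3/4:ℝ) ^ (0.2 * (n:ℝ))))) := by
          gcongr; norm_num
      _ = ((n:ℝ) ^ 2 * 81 ^ s * ((n:ℝ) ^ s * n ^ s * (2 ^ s * 2 ^ s))) *
          (2 ^ (binH ε * n) * 2 ^ (2 * ε * n) * (4 ^ n * (3/4:ℝ) ^ (0.2 * (n:ℝ)))) := by
          rw [h4]; ring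
      _ < 2 ^ ((binH ε - 2 * ε) * n) *
          (2 ^ (binH ε * n) * 2 ^ (2 * ε * n) * (4 ^ n * (3/4:ℝ) ^ (0.2 * (n:ℝ)))) := by
          gcongr
      _ = (2 ^ ((binH ε - 2 * ε) * n) * 2 ^ (binH ε * n) * 2 ^ (2 * ε * n)) *
          (3/4:ℝ) ^ (0.2 * (n:ℝ)) * 4 ^ n := by ring
      _ = _ := by
          rw [← Real.rpow_add (by norm_num), ← Real.rpow_add (by norm_num)]
          congr 3; ring
  set M := ((m:ℝ) ^ s * m ^ s * (2 ^ s * 2 ^ s)) * 2 ^ (binH ε * n) * (4 ^ (ε * n) * T) with hMdef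
  have hM0 : 0 ≤ M := by positivity
  clear_value M
  calc (n:ℝ) ^ (2 * t) * (Fnum m * 3 ^ (4 * t * t) * M ^ t)
      = ((n:ℝ) ^ 2 * 81 ^ t * M) ^ t * Fnum m := by
        rw [mul_pow, mul_pow, ← pow_mul, ← pow_mul, show (81:ℝ) = 3 ^ 4 by norm_num, ← pow_mul,
          mul_assoc 4 t t]
        ring
    _ < (2 ^ (2 * binH ε * n) * (3/4:ℝ) ^ (0.2 * (n:ℝ)) * 4 ^ n) ^ t * Fnum m := by
        have := pow_lt_pow_left₀ hper (by positivity) (by omega : t ≠ 0)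
        gcongr
    _ = _ := by
        rw [mul_pow, mul_pow, ← pow_mul, ← Real.rpow_mul_natCast (by norm_num),
          ← Real.rpow_mul_natCast (by norm_num)]
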